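/- arXiv:0710.0037 — 2 statements merged into one kernel-verified Lean document; each statement's English description precedes it below -/
import Mathlib

section
/- For every complex number s with 0 < Re(s) < 1, the Riemann zeta function satisfies ζ(s) = (π^{s-1} / (1 - 2^{1-s})) · sin(πs/2) · Σ_{n=1}^{∞} (2 - 2^{s-2n}) · Γ(2n - s + 1) · ζ(2n - s + 1) / Γ(2n + 2). -/
open Complex Real

lemma norm_Gamma_le_Gamma_re {z : ℂ} (hz : 0 < z.re) : ‖Complex.Gamma z‖ ≤ Real.Gamma z.re := by
  rw [Complex.Gamma_eq_integral hz, Real.Gamma_eq_integral hz, Complex.GammaIntegral]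
  refine (MeasureTheory.norm_integral_le_integral_norm _).trans_eq
    (MeasureTheory.setIntegral_congr_fun measurableSet_Ioi fun x hx => ?_)
  have hx : 0 < x := hx
  simp only [norm_mul, norm_cpow_eq_rpow_re_of_pos hx, Complex.norm_real, Real.norm_eq_abs,
    Real.abs_exp]
  simp

/-- The terms telescope: `Γ(j - σ) / (j - 1)! - Γ(j + 1 - σ) / j! = σ Γ(j - σ) / j!`. -/
lemma summable_Gamma_sub_div_factorial_of_real {σ : ℝ} (h0 : 0 < σ) (h1 : σ < 1) :
    Summable fun j : ℕ => Real.Gamma (j + 1 - σ) / (j + 1).factorial := by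
  have hG (j : ℕ) : 0 < Real.Gamma (j + 1 - σ) := Real.Gamma_pos_of_pos (by
    have : (0 : ℝ) ≤ j := j.cast_nonneg
    linarith)
  refine summable_of_sum_range_le (c := Real.Gamma (1 - σ) / σ) (fun j => by
    have := hG j; positivity) fun n => ?_
  have key : ∑ j ∈ Finset.range n, Real.Gamma (j + 1 - σ) / (j + 1).factorial
      = (Real.Gamma (1 - σ) - Real.Gamma (n + 1 - σ) / n.factorial) / σ := by
    induction n with
    | zero => simp
    | succ n ih =>
      have hn : (n : ℝ) + 1 - σ ≠ 0 := by
        have : (0 : ℝ) ≤ n := n.cast_nonneg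
        linarith
      have hf : (n.factorial : ℝ) ≠ 0 := by positivity
      have hn1 : (n : ℝ) + 1 ≠ 0 := by positivity
      have hr : Real.Gamma ((n : ℝ) + 1 + 1 - σ) = (n + 1 - σ) * Real.Gamma (n + 1 - σ) := by
        rw [← Real.Gamma_add_one hn]; ring_nf
      rw [Finset.sum_range_succ, ih]
      push_cast [Nat.factorial_succ]
      rw [hr]
      field_simp
      ring
  rw [key]
  have := hG n
  gcongr
  have : 0 ≤ Real.Gamma (n + 1 - σ) / n.factorial := by positivity
  linarith

lemma norm_Gamma_sub_div_factorial_le {s : ℂ} (h1 : s.re < 1) (j : ℕ) :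
    ‖Complex.Gamma ((j + 1 : ℕ) - s) / (j + 1).factorial‖ ≤
      Real.Gamma (j + 1 - s.re) / (j + 1).factorial := by
  rw [norm_div, Complex.norm_natCast]
  gcongr
  have hre : (((j + 1 : ℕ) : ℂ) - s).re = j + 1 - s.re := by simp
  rw [← hre]
  refine norm_Gamma_le_Gamma_re ?_
  rw [hre]
  have : (0 : ℝ) ≤ j := j.cast_nonneg
  linarith

lemma summable_norm_Gamma_sub_div_factorial {s : ℂ} (h0 : 0 < s.re) (h1 : s.re < 1) :
    Summable fun j : ℕ => ‖Complex.Gamma (j - s) / j.factorial‖ := by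
  rw [← summable_nat_add_iff 1]
  exact (summable_Gamma_sub_div_factorial_of_real h0 h1).of_nonneg_of_le
    (fun _ => norm_nonneg _) (norm_Gamma_sub_div_factorial_le h1)

lemma Gamma_sub_div_factorial {s : ℂ} (hs : ∀ n : ℕ, s ≠ n) (j : ℕ) :
    Complex.Gamma (j - s) / j.factorial = Complex.Gamma (-s) * ((-1) ^ j * Ring.choose s j) := by
  have hch (j : ℕ) : Ring.choose s j = (descPochhammer ℤ j).smeval s / j.factorial := by
    rw [eq_div_iff (by exact_mod_cast j.factorial_ne_zero), ← nsmul_eq_mul',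
      Ring.descPochhammer_eq_factorial_smul_choose]
  rw [hch, mul_div_assoc', mul_div_assoc']
  congr 1
  induction j with
  | zero => simp
  | succ j ih =>
    have hr : Complex.Gamma ((j + 1 : ℕ) - s) = (j - s) * Complex.Gamma (j - s) := by
      rw [← Complex.Gamma_add_one _ (sub_ne_zero.2 (hs j).symm)]; push_cast; ring_nf
    rw [hr, ih]
    simp [descPochhammer_succ_right, Polynomial.smeval_mul, Polynomial.smeval_natCast]
    ring

lemma hasSum_Gamma_sub_div_factorial_mul_pow {s : ℂ} (h0 : 0 < s.re) (h1 : s.re < 1) {x : ℝ}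
    (hx : x ∈ Set.Icc (-1) 1) :
    HasSum (fun j : ℕ => Complex.Gamma (j - s) / j.factorial * (x : ℂ) ^ j)
      (Complex.Gamma (-s) * ((1 - x : ℝ) : ℂ) ^ s) := by
  have hs (n : ℕ) : s ≠ n := by
    rintro rfl
    simp only [natCast_re] at h0 h1
    have h0 : 0 < n := by exact_mod_cast h0
    have h1 : n < 1 := by exact_mod_cast h1
    omega
  have hbound (j : ℕ) (x : ℝ) (hx : x ∈ Set.Icc (-1) 1) :
      ‖Complex.Gamma (j - s) / j.factorial * (x : ℂ) ^ j‖ ≤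
        ‖Complex.Gamma (j - s) / j.factorial‖ := by
    rw [norm_mul, norm_pow, norm_real]
    exact mul_le_of_le_one_right (norm_nonneg _)
      (pow_le_one₀ (norm_nonneg _) (abs_le.2 hx))
  have hsum := summable_norm_Gamma_sub_div_factorial h0 h1
  have heq : Set.EqOn (fun x : ℝ => ∑' j : ℕ, Complex.Gamma (j - s) / j.factorial * (x : ℂ) ^ j)
      (fun x : ℝ => Complex.Gamma (-s) * ((1 - x : ℝ) : ℂ) ^ s) (Set.Icc (-1) 1) := by
    refine Set.EqOn.of_subset_closure (s := Set.Ioo (-1) 1) (fun x hx => ?_)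
      (continuousOn_tsum (fun j => by fun_prop) hsum hbound) ?_ Set.Ioo_subset_Icc_self
      (closure_Ioo (by norm_num)).ge
    · have := (one_add_cpow_hasFPowerSeriesOnBall_zero (a := s)).hasSum (y := -(x : ℂ)) (by
        rw [← ENNReal.ofReal_one, Metric.eball_ofReal]
        simpa [abs_lt] using hx)
      have := (this.mul_left (Complex.Gamma (-s))).tsum_eq
      simp only [binomialSeries_apply, List.ofFn_const, List.prod_replicate, smul_eq_mul,
        zero_add] at this
      simp only [ofReal_sub, ofReal_one, sub_eq_add_neg (1 : ℂ)]
      rw [← this]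
      refine tsum_congr fun j => ?_
      rw [Gamma_sub_div_factorial hs, neg_pow (x : ℂ)]
      ring
    · refine ContinuousOn.mul continuousOn_const (Continuous.continuousOn ?_)
      exact (continuous_ofReal_cpow_const h0).comp (continuous_const.sub continuous_id)
  have hx_eq := heq hx
  dsimp only at hx_eq
  rw [← hx_eq]
  exact (Summable.of_norm_bounded hsum fun j => hbound j x hx).hasSum

lemma hasDerivAt_ofReal_cpow {x : ℝ} (hx : 0 < x) (w : ℂ) :
    HasDerivAt (fun y : ℝ => (y : ℂ) ^ w) (w * (x : ℂ) ^ (w - 1)) x := by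
  have := ((hasDerivAt_id (x : ℂ)).cpow_const (c := w) (ofReal_mem_slitPlane.2 hx)).comp_ofReal
  simpa using this

lemma norm_ofReal_cpow_neg_sub_le {a x : ℝ} (ha : 0 < a) (hx : x ∈ Set.Icc a (a + 1)) {w : ℂ}
    (hw : 0 < w.re) :
    ‖(x : ℂ) ^ (-w) - (a : ℂ) ^ (-w)‖ ≤ ‖w‖ * a ^ (-w.re - 1) := by
  have h := (convex_Icc a (a + 1)).norm_image_sub_le_of_norm_hasDerivWithin_le
    (f := fun y : ℝ => (y : ℂ) ^ (-w)) (C := ‖w‖ * a ^ (-w.re - 1))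
    (fun y hy => (hasDerivAt_ofReal_cpow (ha.trans_le hy.1) (-w)).hasDerivWithinAt)
    (fun y hy => ?_) (Set.left_mem_Icc.2 (by linarith)) hx
  · refine h.trans (mul_le_of_le_one_right (by positivity) ?_)
    rw [Real.norm_eq_abs, abs_le]
    constructor <;> linarith [hx.1, hx.2]
  · rw [norm_mul, norm_neg, norm_cpow_eq_rpow_re_of_pos (ha.trans_le hy.1)]
    gcongr ?_ * ?_
    simpa using Real.rpow_le_rpow_of_nonpos ha hy.1 (by linarith : -w.re - 1 ≤ 0)

/-- `(1 - w) (n^(-w) - ∫_n^(n+1) x^(-w) dx)`, shifted to start at `n = 1`. -/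
noncomputable def zetaCorrection (w : ℂ) (n : ℕ) : ℂ :=
  (1 - w) * ((n + 1 : ℕ) : ℂ) ^ (-w) - (((n + 2 : ℕ) : ℂ) ^ (1 - w) - ((n + 1 : ℕ) : ℂ) ^ (1 - w))

lemma norm_zetaCorrection_le {w : ℂ} (hw : 0 < w.re) (n : ℕ) :
    ‖zetaCorrection w n‖ ≤ ‖1 - w‖ * ‖w‖ * ((n + 1 : ℕ) : ℝ) ^ (-w.re - 1) := by
  set a : ℝ := ((n + 1 : ℕ) : ℝ) with ha_def
  have ha : 0 < a := by positivity
  have h := (convex_Icc a (a + 1)).norm_image_sub_le_of_norm_hasDerivWithin_le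
    (f := fun y : ℝ => (y : ℂ) ^ (1 - w) - (1 - w) * (a : ℂ) ^ (-w) * y)
    (f' := fun y : ℝ => (1 - w) * (y : ℂ) ^ (-w) - (1 - w) * (a : ℂ) ^ (-w))
    (C := ‖1 - w‖ * ‖w‖ * a ^ (-w.re - 1))
    (fun y hy => ?_) (fun y hy => ?_) (Set.left_mem_Icc.2 (by linarith))
    (Set.right_mem_Icc.2 (by linarith))
  · rw [add_sub_cancel_left, norm_one, mul_one, norm_sub_rev] at h
    convert! h using 2
    simp only [zetaCorrection, ha_def]
    push_cast
    rw [show (n : ℂ) + 1 + 1 = n + 2 by ring]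
    ring
  · have h1 := hasDerivAt_ofReal_cpow (ha.trans_le hy.1) (1 - w)
    rw [show 1 - w - 1 = -w by ring] at h1
    have h2 := ((hasDerivAt_id y).ofReal_comp).const_mul ((1 - w) * (a : ℂ) ^ (-w))
    simpa only [id_eq, ofReal_one, mul_one] using! (h1.sub h2).hasDerivWithinAt
  · rw [← mul_sub, norm_mul, mul_assoc]
    gcongr
    exact norm_ofReal_cpow_neg_sub_le ha hy hw

lemma summable_succ_rpow_neg {σ : ℝ} (hσ : 0 < σ) :
    Summable fun n : ℕ => ((n + 1 : ℕ) : ℝ) ^ (-σ - 1) :=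
  (summable_nat_add_iff 1).2 (Real.summable_nat_rpow.2 (by linarith))

lemma sum_zetaCorrection (w : ℂ) (N : ℕ) :
    ∑ n ∈ Finset.range N, zetaCorrection w n =
      (1 - w) * ∑ n ∈ Finset.range N, ((n + 1 : ℕ) : ℂ) ^ (-w) -
        (((N + 1 : ℕ) : ℂ) ^ (1 - w) - 1) := by
  simp only [zetaCorrection, Finset.sum_sub_distrib, ← Finset.mul_sum]
  rw [← Finset.sum_sub_distrib, Finset.sum_range_sub (fun n : ℕ => ((n + 1 : ℕ) : ℂ) ^ (1 - w))]
  simp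

lemma tendsto_natCast_cpow_zero {w : ℂ} (hw : w.re < 0) :
    Filter.Tendsto (fun n : ℕ => (n : ℂ) ^ w) Filter.atTop (nhds 0) := by
  rw [tendsto_zero_iff_norm_tendsto_zero]
  refine ((tendsto_rpow_neg_atTop (y := -w.re) (by linarith)).comp
    tendsto_natCast_atTop_atTop).congr' ?_
  filter_upwards [Filter.eventually_gt_atTop 0] with n hn
  simp [norm_natCast_cpow_of_pos hn]

lemma tsum_zetaCorrection_of_one_lt_re {w : ℂ} (hw : 1 < w.re) :
    ∑' n, zetaCorrection w n = 1 - riemannZeta₁ w := by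
  have hw1 : w ≠ 1 := by rintro rfl; simp at hw
  have hs : Summable (zetaCorrection w) := .of_norm_bounded
    ((summable_succ_rpow_neg (by linarith)).mul_left _) (norm_zetaCorrection_le (by linarith))
  refine tendsto_nhds_unique hs.hasSum.tendsto_sum_nat ?_
  simp only [sum_zetaCorrection]
  have h1 : HasSum (fun n : ℕ => ((n + 1 : ℕ) : ℂ) ^ (-w)) (riemannZeta w) := by
    have h := (summable_nat_add_iff 1).2 (Complex.summable_one_div_nat_cpow.2 hw)
    rw [zeta_eq_tsum_one_div_nat_add_one_cpow hw]
    simpa [cpow_neg] using h.hasSum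
  have h2 : Filter.Tendsto (fun n : ℕ => ((n + 1 : ℕ) : ℂ) ^ (1 - w)) Filter.atTop (nhds 0) :=
    (Filter.tendsto_add_atTop_iff_nat (f := fun n : ℕ => (n : ℂ) ^ (1 - w)) 1).2
      (tendsto_natCast_cpow_zero (by simpa using hw))
  have := (h1.tendsto_sum_nat.const_mul (1 - w)).sub (h2.sub_const 1)
  convert this using 2
  rw [riemannZeta_eq_inv_sub_mul hw1]
  have : w - 1 ≠ 0 := sub_ne_zero.2 hw1
  field_simp
  ring

lemma tsum_zetaCorrection {w : ℂ} (hw : 0 < w.re) :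
    ∑' n, zetaCorrection w n = 1 - riemannZeta₁ w := by
  set R : ℝ := ‖w‖ + 3
  set U : Set ℂ := {z | w.re / 2 < z.re} ∩ Metric.ball 0 R
  have hUo : IsOpen U := (isOpen_lt continuous_const continuous_re).inter Metric.isOpen_ball
  have hUc : IsPreconnected U :=
    ((convex_halfSpace_re_gt _).inter (convex_ball _ _)).isPreconnected
  have hwn : w.re ≤ ‖w‖ := Complex.re_le_norm w
  have hwU : w ∈ U := ⟨by simp only [Set.mem_ofPred_eq]; linarith, by simp [R]⟩
  have hd : DifferentiableOn ℂ (fun z => ∑' n, zetaCorrection z n) U := by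
    refine differentiableOn_tsum_of_summable_norm
      (u := fun n : ℕ => (1 + R) * R * ((n + 1 : ℕ) : ℝ) ^ (-(w.re / 2) - 1))
      ((summable_succ_rpow_neg (by linarith)).mul_left _) (fun n => ?_) hUo (fun n z hz => ?_)
    · refine Differentiable.differentiableOn fun z => ?_
      unfold zetaCorrection
      have h1 : ((n + 1 : ℕ) : ℂ) ≠ 0 := by exact_mod_cast n.succ_ne_zero
      have h2 : ((n + 2 : ℕ) : ℂ) ≠ 0 := by exact_mod_cast (n + 1).succ_ne_zero
      refine DifferentiableAt.sub (.mul (by fun_prop) (.const_cpow (by fun_prop) (.inl h1)))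
        (.sub (.const_cpow (by fun_prop) (.inl h2)) (.const_cpow (by fun_prop) (.inl h1)))
    · obtain ⟨hz1, hz2⟩ := hz
      simp only [Set.mem_ofPred_eq] at hz1
      rw [mem_ball_zero_iff] at hz2
      refine (norm_zetaCorrection_le (by linarith) n).trans ?_
      gcongr
      · exact (norm_sub_le _ _).trans (by rw [norm_one]; linarith)
      · exact_mod_cast n.succ_pos
  have hp : ((w.re + 2 : ℝ) : ℂ) ∈ U := by
    refine ⟨by simp only [Set.mem_ofPred_eq, ofReal_re]; linarith, ?_⟩
    rw [mem_ball_zero_iff, norm_real, Real.norm_of_nonneg (by linarith)]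
    simp only [R]; linarith
  refine (hd.analyticOnNhd hUo).eqOn_of_preconnected_of_eventuallyEq
    (g := fun z => 1 - riemannZeta₁ z)
    (((differentiable_const _).sub differentiable_riemannZeta₁).differentiableOn.analyticOnNhd hUo)
    hUc hp ?_ hwU
  filter_upwards [(isOpen_lt continuous_const continuous_re).mem_nhds
    (show (1 : ℝ) < ((w.re + 2 : ℝ) : ℂ).re by rw [ofReal_re]; linarith)] with z hz
  exact tsum_zetaCorrection_of_one_lt_re hz

lemma tendsto_sum_cpow_sub_riemannZeta {w : ℂ} (hw : 0 < w.re) (hw1 : w ≠ 1) :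
    Filter.Tendsto (fun N : ℕ => ∑ n ∈ Finset.range N, ((n + 1 : ℕ) : ℂ) ^ (-w) -
      (N : ℂ) ^ (1 - w) / (1 - w)) Filter.atTop (nhds (riemannZeta w)) := by
  have hs : Summable (zetaCorrection w) := .of_norm_bounded
    ((summable_succ_rpow_neg hw).mul_left _) (norm_zetaCorrection_le hw)
  have h := hs.hasSum.tendsto_sum_nat
  rw [tsum_zetaCorrection hw] at h
  have hw0 : 1 - w ≠ 0 := sub_ne_zero.2 hw1.symm
  have hw0' : w - 1 ≠ 0 := sub_ne_zero.2 hw1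
  have h2 : Filter.Tendsto (fun n : ℕ => ((n + 1 : ℕ) : ℂ) ^ (-w)) Filter.atTop (nhds 0) :=
    (Filter.tendsto_add_atTop_iff_nat (f := fun n : ℕ => (n : ℂ) ^ (-w)) 1).2
      (tendsto_natCast_cpow_zero (by simpa using hw))
  rw [← Filter.tendsto_add_atTop_iff_nat 1]
  have h3 := ((h.sub_const 1).div_const (1 - w)).add h2
  convert h3 using 2 with N
  · rw [sum_zetaCorrection, Finset.sum_range_succ]
    field_simp
    ring
  · rw [riemannZeta_eq_inv_sub_mul hw1]
    field_simp
    ring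

lemma tendsto_sum_odd_cpow_sub_riemannZeta {w : ℂ} (hw : 0 < w.re) (hw1 : w ≠ 1) :
    Filter.Tendsto (fun K : ℕ => ∑ k ∈ Finset.range K, ((2 * k + 1 : ℕ) : ℂ) ^ (-w) -
      ((2 * K : ℕ) : ℂ) ^ (1 - w) / (2 * (1 - w))) Filter.atTop
      (nhds ((1 - 2 ^ (-w)) * riemannZeta w)) := by
  have h := tendsto_sum_cpow_sub_riemannZeta hw hw1
  have h2 := h.comp (Filter.tendsto_id.const_mul_atTop' (two_pos : (0 : ℕ) < 2))
  have h3 := h2.sub (h.const_mul (2 ^ (-w)))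
  rw [sub_mul, one_mul]
  refine h3.congr fun K => ?_
  simp only [Function.comp_apply, id]
  have hsplit : ∑ n ∈ Finset.range (2 * K), ((n + 1 : ℕ) : ℂ) ^ (-w) =
      ∑ k ∈ Finset.range K, ((2 * k + 1 : ℕ) : ℂ) ^ (-w) +
        2 ^ (-w) * ∑ k ∈ Finset.range K, ((k + 1 : ℕ) : ℂ) ^ (-w) := by
    induction K with
    | zero => simp
    | succ K ih =>
      have : (((2 * K + 1 + 1 : ℕ) : ℂ)) ^ (-w) = 2 ^ (-w) * ((K + 1 : ℕ) : ℂ) ^ (-w) := by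
        rw [show 2 * K + 1 + 1 = 2 * (K + 1) by ring, Nat.cast_mul, natCast_mul_natCast_cpow,
          Nat.cast_ofNat]
      rw [mul_add_one, Finset.sum_range_succ, Finset.sum_range_succ, ih, this,
        Finset.sum_range_succ, Finset.sum_range_succ]
      ring
  have hw0 : 1 - w ≠ 0 := sub_ne_zero.2 hw1.symm
  have hcp : ((2 * K : ℕ) : ℂ) ^ (1 - w) = 2 * 2 ^ (-w) * (K : ℂ) ^ (1 - w) := by
    rw [Nat.cast_mul, natCast_mul_natCast_cpow, Nat.cast_ofNat, sub_eq_add_neg,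
      cpow_add _ _ two_ne_zero, cpow_one]
  rw [hsplit, hcp]
  field_simp
  ring

lemma hasSum_odd_cpow {w : ℂ} (hw : 1 < w.re) :
    HasSum (fun k : ℕ => ((2 * k + 1 : ℕ) : ℂ) ^ (-w)) ((1 - 2 ^ (-w)) * riemannZeta w) := by
  have hw1 : w ≠ 1 := by rintro rfl; simp at hw
  have hs : Summable (fun k : ℕ => ((2 * k + 1 : ℕ) : ℂ) ^ (-w)) := by
    have h : Summable (fun n : ℕ => (n : ℂ) ^ (-w)) := by
      simpa [cpow_neg] using Complex.summable_one_div_nat_cpow.2 hw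
    exact h.comp_injective (i := fun k : ℕ => 2 * k + 1) fun a b hab => by simpa using hab
  have h0 : Filter.Tendsto (fun K : ℕ => ((2 * K : ℕ) : ℂ) ^ (1 - w) / (2 * (1 - w)))
      Filter.atTop (nhds 0) := by
    simpa using ((tendsto_natCast_cpow_zero (w := 1 - w) (by simpa using hw)).comp
      (Filter.tendsto_id.const_mul_atTop' (two_pos : (0 : ℕ) < 2))).div_const (2 * (1 - w))
  have h := (tendsto_sum_odd_cpow_sub_riemannZeta (by linarith) hw1).add h0
  simp only [sub_add_cancel, add_zero] at h
  rw [← tendsto_nhds_unique hs.hasSum.tendsto_sum_nat h]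
  exact hs.hasSum

/-- The summand of the absolutely convergent double series over `n` and over odd `2 k + 1`. -/
noncomputable def oddTerm (s : ℂ) (n k : ℕ) : ℂ :=
  2 * (Complex.Gamma ((2 * n + 3 : ℕ) - s) / (2 * n + 3).factorial) *
    ((2 * k + 1 : ℕ) : ℂ) ^ (-((2 * n + 3 : ℕ) - s))

lemma hasSum_oddTerm_left {s : ℂ} (h0 : 0 < s.re) (h1 : s.re < 1) (k : ℕ) :
    HasSum (fun n : ℕ => oddTerm s n k)
      (Complex.Gamma (-s) * (((2 * k : ℕ) : ℂ) ^ s - ((2 * (k + 1) : ℕ) : ℂ) ^ s) -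
        2 * Complex.Gamma (1 - s) * ((2 * k + 1 : ℕ) : ℂ) ^ (-(1 - s))) := by
  obtain ⟨m, hm_def⟩ : ∃ m : ℝ, m = ((2 * k + 1 : ℕ) : ℝ) := ⟨_, rfl⟩
  have hm1 : 1 ≤ m := by rw [hm_def]; exact_mod_cast Nat.le_add_left 1 (2 * k)
  have hm : 0 < m := by linarith
  have hmC : (m : ℂ) ≠ 0 := by exact_mod_cast hm.ne'
  have hcast : ((2 * k + 1 : ℕ) : ℂ) = (m : ℂ) := by rw [hm_def]; simp
  have hx : m⁻¹ ∈ Set.Icc (-1) 1 := ⟨by have := inv_pos.2 hm; linarith, inv_le_one_of_one_le₀ hm1⟩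
  have hx' : -m⁻¹ ∈ Set.Icc (-1) 1 := ⟨by linarith [hx.2], by linarith [hx.1]⟩
  have hdiff := (hasSum_Gamma_sub_div_factorial_mul_pow h0 h1 hx).sub
    (hasSum_Gamma_sub_div_factorial_mul_pow h0 h1 hx')
  have hinj : Function.Injective fun n : ℕ => 2 * n + 1 := fun a b hab => by simpa using hab
  rw [← hinj.hasSum_iff fun j hj => ?_] at hdiff
  · have hmul := ((hasSum_nat_add_iff' 1).2 hdiff).mul_left ((m : ℂ) ^ s)
    have hpow (J : ℕ) : (m : ℂ) ^ (-((J : ℂ) - s)) = (m : ℂ) ^ s * ((m : ℂ) ^ J)⁻¹ := by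
      rw [neg_sub, cpow_sub _ _ hmC, cpow_natCast, div_eq_mul_inv]
    have hscale (y : ℝ) (hy : 0 ≤ y) : (m : ℂ) ^ s * (y : ℂ) ^ s = ((m * y : ℝ) : ℂ) ^ s := by
      rw [← mul_cpow_ofReal_nonneg hm.le hy, ofReal_mul]
    convert! hmul using 1
    · ext n
      have hodd : Odd (2 * (n + 1) + 1) := ⟨n + 1, rfl⟩
      rw [oddTerm, hcast, hpow]
      simp only [Function.comp_apply, ofReal_neg, hodd.neg_pow, ofReal_inv, inv_pow]
      rw [show 2 * (n + 1) + 1 = 2 * n + 3 by ring]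
      ring
    · have e1 : m * (1 - m⁻¹) = ((2 * k : ℕ) : ℝ) := by
        rw [mul_sub, mul_inv_cancel₀ hm.ne', hm_def]; push_cast; ring
      have e2 : m * (1 - -m⁻¹) = ((2 * (k + 1) : ℕ) : ℝ) := by
        rw [sub_neg_eq_add, mul_add, mul_inv_cancel₀ hm.ne', hm_def]; push_cast; ring
      have hp1 := hpow 1
      rw [Nat.cast_one, pow_one] at hp1
      have hs1 := hscale (1 - m⁻¹) (by linarith [hx.2])
      have hs2 := hscale (1 - -m⁻¹) (by linarith [hx.1])
      rw [e1, ofReal_natCast] at hs1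
      rw [e2, ofReal_natCast] at hs2
      rw [hcast, hp1, ← hs1, ← hs2]
      simp
      ring
  · have hj : Even j := by
      rw [← Nat.not_odd_iff_even]
      rintro ⟨n, rfl⟩
      exact hj ⟨n, rfl⟩
    simp [hj.neg_pow]

lemma hasSum_oddTerm_right {s : ℂ} (h1 : s.re < 1) (n : ℕ) :
    HasSum (fun k : ℕ => oddTerm s n k)
      (2 * (Complex.Gamma ((2 * n + 3 : ℕ) - s) / (2 * n + 3).factorial) *
        ((1 - 2 ^ (-((2 * n + 3 : ℕ) - s))) * riemannZeta ((2 * n + 3 : ℕ) - s))) := by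
  refine (hasSum_odd_cpow ?_).mul_left _
  have : (0 : ℝ) ≤ n := n.cast_nonneg
  rw [sub_re, natCast_re]
  push_cast
  linarith

lemma summable_oddTerm {s : ℂ} (h0 : 0 < s.re) (h1 : s.re < 1) :
    Summable fun p : ℕ × ℕ => oddTerm s p.1 p.2 := by
  have hinj : Function.Injective fun n : ℕ => 2 * n + 3 := fun a b hab => by simpa using hab
  have hc : Summable fun n : ℕ =>
      2 * ‖Complex.Gamma ((2 * n + 3 : ℕ) - s) / (2 * n + 3).factorial‖ :=
    ((summable_norm_Gamma_sub_div_factorial h0 h1).comp_injective hinj).mul_left 2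
  have hk : Summable fun k : ℕ => ((2 * k + 1 : ℕ) : ℝ) ^ (-2 : ℝ) :=
    (Real.summable_nat_rpow.2 (by norm_num : (-2 : ℝ) < -1)).comp_injective
      (i := fun k : ℕ => 2 * k + 1) fun a b hab => by simpa using hab
  refine .of_norm_bounded (hc.mul_of_nonneg hk (fun n => by dsimp only [Pi.zero_apply]; positivity)
    (fun k => by dsimp only [Pi.zero_apply]; positivity)) fun p => ?_
  rw [oddTerm, norm_mul, norm_mul, Complex.norm_ofNat, norm_natCast_cpow_of_pos (by positivity)]
  gcongr
  · exact_mod_cast Nat.le_add_left 1 (2 * p.2)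
  · have : (0 : ℝ) ≤ p.1 := p.1.cast_nonneg
    rw [neg_re, sub_re, natCast_re]
    push_cast
    linarith

lemma hasSum_Gamma_mul_riemannZeta {s : ℂ} (h0 : 0 < s.re) (h1 : s.re < 1) :
    HasSum (fun n : ℕ => (2 - (2 : ℂ) ^ (s - 2 * ((n : ℂ) + 1))) *
        Complex.Gamma (2 * ((n : ℂ) + 1) - s + 1) * riemannZeta (2 * ((n : ℂ) + 1) - s + 1) /
        Complex.Gamma (2 * ((n : ℂ) + 1) + 2))
      (-2 * Complex.Gamma (1 - s) * ((1 - 2 ^ (-(1 - s))) * riemannZeta (1 - s))) := by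
  have hs0 : s ≠ 0 := by rintro rfl; simp at h0
  have hf := summable_oddTerm h0 h1
  have hA := hf.hasSum.prod_fiberwise fun n => hasSum_oddTerm_right h1 n
  have hE := HasSum.prod_fiberwise (f := fun p : ℕ × ℕ => oddTerm s p.2 p.1)
    ((Equiv.prodComm ℕ ℕ).hasSum_iff.2 hf.hasSum) fun k => hasSum_oddTerm_left h0 h1 k
  have hlim := (tendsto_sum_odd_cpow_sub_riemannZeta (w := 1 - s) (by simpa using h1)
    (by simpa using hs0)).const_mul (-2 * Complex.Gamma (1 - s))
  have hG : Complex.Gamma (1 - s) = -s * Complex.Gamma (-s) := by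
    rw [← Complex.Gamma_add_one _ (neg_ne_zero.2 hs0)]; ring_nf
  have hval := tendsto_nhds_unique hE.tendsto_sum_nat (hlim.congr fun K => by
    rw [Finset.sum_sub_distrib, ← Finset.mul_sum, ← Finset.mul_sum,
      Finset.sum_range_sub' (fun k : ℕ => ((2 * k : ℕ) : ℂ) ^ s), hG, sub_sub_cancel]
    simp only [mul_zero, Nat.cast_zero, zero_cpow hs0]
    field_simp
    ring)
  rw [← hval]
  convert! hA using 1
  ext n
  have hw : ((2 * n + 3 : ℕ) : ℂ) - s = 2 * ((n : ℂ) + 1) - s + 1 := by push_cast; ring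
  have hfac : Complex.Gamma (2 * ((n : ℂ) + 1) + 2) = ((2 * n + 3).factorial : ℂ) := by
    rw [← Complex.Gamma_nat_eq_factorial]; push_cast; ring_nf
  have h2 : (2 : ℂ) ^ (s - 2 * ((n : ℂ) + 1)) = 2 * 2 ^ (-(2 * ((n : ℂ) + 1) - s + 1)) := by
    rw [show s - 2 * ((n : ℂ) + 1) = 1 + -(2 * ((n : ℂ) + 1) - s + 1) by ring,
      cpow_add _ _ two_ne_zero, cpow_one]
  rw [hw, hfac, h2]
  ring

/-- For every complex `s` with `0 < Re s < 1`,
`ζ(s) = (π^(s-1) / (1 - 2^(1-s))) · sin(πs/2) ·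
  Σ_{n=1}^∞ (2 - 2^(s-2n)) Γ(2n - s + 1) ζ(2n - s + 1) / Γ(2n + 2)`,
and the series converges. -/
theorem stmt_0 (s : ℂ) (h0 : 0 < s.re) (h1 : s.re < 1) :
    (Summable fun n : ℕ =>
      (2 - (2 : ℂ) ^ (s - 2 * ((n : ℂ) + 1))) *
        Complex.Gamma (2 * ((n : ℂ) + 1) - s + 1) *
        riemannZeta (2 * ((n : ℂ) + 1) - s + 1) /
        Complex.Gamma (2 * ((n : ℂ) + 1) + 2)) ∧
    riemannZeta s =
      (π : ℂ) ^ (s - 1) / (1 - (2 : ℂ) ^ (1 - s)) * Complex.sin (π * s / 2) *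
        ∑' n : ℕ,
          (2 - (2 : ℂ) ^ (s - 2 * ((n : ℂ) + 1))) *
            Complex.Gamma (2 * ((n : ℂ) + 1) - s + 1) *
            riemannZeta (2 * ((n : ℂ) + 1) - s + 1) /
            Complex.Gamma (2 * ((n : ℂ) + 1) + 2) := by
  have h := hasSum_Gamma_mul_riemannZeta h0 h1
  refine ⟨h.summable, ?_⟩
  rw [h.tsum_eq]
  have hs0 : s ≠ 0 := by rintro rfl; simp at h0
  have hfe := riemannZeta_one_sub (s := 1 - s) (fun n hn => by
    have hre := congrArg re hn
    simp only [sub_re, one_re, neg_re, natCast_re] at hre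
    have : (0 : ℝ) ≤ n := n.cast_nonneg
    linarith) (by simpa using hs0)
  have hcos : Complex.cos (π * (1 - s) / 2) = Complex.sin (π * s / 2) := by
    rw [← Complex.cos_pi_div_two_sub]; ring_nf
  have hpow : (2 * (π : ℂ)) ^ (s - 1) = 2 ^ (s - 1) * (π : ℂ) ^ (s - 1) := by
    have := mul_cpow_ofReal_nonneg (zero_le_two (α := ℝ)) pi_pos.le (s - 1)
    simpa using this
  have hne : (2 : ℂ) ^ (s - 1) ≠ 1 := fun he => by
    have hn := congrArg norm he
    rw [← ofReal_ofNat, norm_cpow_eq_rpow_re_of_pos two_pos, norm_one] at hn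
    exact (Real.rpow_lt_one_of_one_lt_of_neg one_lt_two
      (show (s - 1).re < 0 by simpa using h1)).ne hn
  have hne0 : (2 : ℂ) ^ (s - 1) ≠ 0 := by simp [cpow_eq_zero_iff]
  have hinv : (2 : ℂ) ^ (1 - s) = ((2 : ℂ) ^ (s - 1))⁻¹ := by rw [← cpow_neg, neg_sub]
  rw [sub_sub_cancel, hcos, neg_sub, hpow] at hfe
  rw [hfe, neg_sub, hinv]
  have hden : (2 : ℂ) ^ (s - 1) - 1 ≠ 0 := sub_ne_zero.2 hne
  have hden' : 1 - ((2 : ℂ) ^ (s - 1))⁻¹ = ((2 : ℂ) ^ (s - 1) - 1) / 2 ^ (s - 1) := by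
    field_simp
  rw [hden']
  field_simp
  ring
end

section
/- ζ(3) = -(4/3) · π² · ( -log 2 / 6 + Σ_{n=1}^{∞} (2 - 2^{1-2n}) · Γ(2n) · ζ(2n) / Γ(2n + 4) ), where the series converges. -/
open Complex Real

/-- The real Dirichlet series `∑ 1 / k ^ s` at a natural number `s`. -/
noncomputable def realZeta (s : ℕ) : ℝ := ∑' k : ℕ, 1 / ((k : ℝ) + 1) ^ s

lemma hasSum_realZeta {s : ℕ} (hs : 1 < s) :
    HasSum (fun k : ℕ => 1 / ((k : ℝ) + 1) ^ s) (realZeta s) := by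
  have h := (summable_nat_add_iff 1).2 (Real.summable_one_div_nat_pow.2 hs)
  simpa [realZeta] using h.hasSum

lemma riemannZeta_natCast_eq_realZeta {s : ℕ} (hs : 1 < s) :
    riemannZeta s = (realZeta s : ℂ) := by
  rw [zeta_eq_tsum_one_div_nat_add_one_cpow (by simpa using hs), realZeta, Complex.ofReal_tsum]
  simp

lemma realZeta_nonneg (s : ℕ) : 0 ≤ realZeta s := tsum_nonneg fun _ => by positivity

lemma realZeta_le {s : ℕ} (hs : 2 ≤ s) : realZeta s ≤ realZeta 2 := by
  refine hasSum_le (fun k => ?_) (hasSum_realZeta (s := s) (by lia)) (hasSum_realZeta one_lt_two)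
  gcongr
  simp

lemma hasSum_neg_log_euler_factor {x : ℝ} (hx : 0 < x) (hx1 : x < 1) :
    HasSum (fun k : ℕ => -Real.log (1 - x ^ 2 / ((k : ℝ) + 1) ^ 2))
      (-Real.log (Real.sin (π * x) / (π * x))) := by
  have hfac : ∀ k : ℕ, 0 < 1 - x ^ 2 / ((k : ℝ) + 1) ^ 2 := fun k => by
    rw [sub_pos, div_lt_one (by positivity)]
    nlinarith [(k.cast_nonneg : (0 : ℝ) ≤ k)]
  have hsin : 0 < Real.sin (π * x) :=
    Real.sin_pos_of_pos_of_lt_pi (by positivity) (by nlinarith [Real.pi_pos])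
  have hpx : 0 < π * x := by positivity
  rw [hasSum_iff_tendsto_nat_of_nonneg fun k => by
    rw [neg_nonneg]
    exact Real.log_nonpos (hfac k).le (by rw [sub_le_self_iff]; positivity)]
  have h := (Real.tendsto_euler_sin_prod x).div_const (π * x)
  have h' := ((Real.continuousAt_log (div_pos hsin hpx).ne').tendsto.comp h).neg
  refine h'.congr fun n => ?_
  rw [Function.comp_apply, mul_div_cancel_left₀ _ hpx.ne', Real.log_prod fun k _ => (hfac k).ne',
    Finset.sum_neg_distrib]

lemma hasSum_realZeta_mul_pow {x : ℝ} (hx : 0 < x) (hx1 : x < 1) :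
    HasSum (fun n : ℕ => realZeta (2 * (n + 1)) * x ^ (2 * (n + 1)) / ((n : ℝ) + 1))
      (-Real.log (Real.sin (π * x) / (π * x))) := by
  have hx2 : x ^ 2 < 1 := by nlinarith
  have hrow : ∀ k : ℕ, HasSum (fun n : ℕ => (x ^ 2 / ((k : ℝ) + 1) ^ 2) ^ (n + 1) / ((n : ℝ) + 1))
      (-Real.log (1 - x ^ 2 / ((k : ℝ) + 1) ^ 2)) := fun k => by
    refine Real.hasSum_pow_div_log_of_abs_lt_one ?_
    rw [abs_of_nonneg (by positivity), div_lt_one (by positivity)]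
    nlinarith [(k.cast_nonneg : (0 : ℝ) ≤ k)]
  have hsum := hasSum_neg_log_euler_factor hx hx1
  let f : ℕ × ℕ → ℝ := fun p => (x ^ 2 / ((p.1 : ℝ) + 1) ^ 2) ^ (p.2 + 1) / ((p.2 : ℝ) + 1)
  have hf : Summable f := by
    rw [summable_prod_of_nonneg fun p => by simp only [f, Pi.zero_apply]; positivity]
    exact ⟨fun k => (hrow k).summable, hsum.summable.congr fun k => (hrow k).tsum_eq.symm⟩
  have hval : ∑' p, f p = -Real.log (Real.sin (π * x) / (π * x)) :=
    (hf.hasSum.prod_fiberwise hrow).unique hsum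
  have hswap : HasSum (f ∘ Equiv.prodComm ℕ ℕ) (-Real.log (Real.sin (π * x) / (π * x))) := by
    rw [Equiv.hasSum_iff, ← hval]
    exact hf.hasSum
  refine hswap.prod_fiberwise fun n => ?_
  have h := (hasSum_realZeta (s := 2 * (n + 1)) (by lia)).mul_right
    (x ^ (2 * (n + 1)) / ((n : ℝ) + 1))
  rw [← mul_div_assoc] at h
  refine h.congr_fun fun k => ?_
  simp only [f, Function.comp_apply, Equiv.prodComm_apply, Prod.swap, div_pow, ← pow_mul]
  field_simp

lemma hasSum_neg_log_cos {x : ℝ} (hx : 0 < x) (hx1 : x < 1) :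
    HasSum (fun n : ℕ => (1 - (1 / 4) ^ (n + 1)) * realZeta (2 * (n + 1)) *
        x ^ (2 * (n + 1)) / ((n : ℝ) + 1))
      (-Real.log (Real.cos (π / 2 * x))) := by
  have h := (hasSum_realZeta_mul_pow hx hx1).sub
    (hasSum_realZeta_mul_pow (x := x / 2) (by positivity) (by linarith))
  have hpx : 0 < π * x := by positivity
  have hpx1 : π * x < π := by nlinarith [Real.pi_pos]
  have hs : 0 < Real.sin (π / 2 * x) :=
    Real.sin_pos_of_pos_of_lt_pi (by linarith) (by linarith)
  have hc : 0 < Real.cos (π / 2 * x) :=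
    Real.cos_pos_of_mem_Ioo ⟨by linarith, by linarith⟩
  convert! h using 1
  · ext n
    rw [div_pow x 2, pow_mul 2 2 (n + 1), div_pow 1 4, one_pow]
    norm_num
    ring
  · rw [show π * x = 2 * (π / 2 * x) by ring, Real.sin_two_mul,
      show π * (x / 2) = π / 2 * x by ring]
    have : 2 * Real.sin (π / 2 * x) * Real.cos (π / 2 * x) / (2 * (π / 2 * x)) =
      Real.sin (π / 2 * x) / (π / 2 * x) * Real.cos (π / 2 * x) := by field_simp
    rw [this, Real.log_mul (div_pos hs (by linarith)).ne' hc.ne']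
    ring

lemma integral_sq_mul_cos {n : ℕ} (hn : n ≠ 0) :
    ∫ x in (0 : ℝ)..1, x ^ 2 * Real.cos (n * (π * x)) = 2 * (-1) ^ n / (π * n) ^ 2 := by
  have hn' : (n : ℝ) ≠ 0 := by exact_mod_cast hn
  have hp : π ≠ 0 := Real.pi_ne_zero
  have hd : ∀ x ∈ Set.uIcc (0 : ℝ) 1, HasDerivAt
      (fun x : ℝ => x ^ 2 * Real.sin (n * (π * x)) / (π * n) +
        2 * x * Real.cos (n * (π * x)) / (π * n) ^ 2 - 2 * Real.sin (n * (π * x)) / (π * n) ^ 3)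
      (x ^ 2 * Real.cos (n * (π * x))) x := fun x _ => by
    have hl : HasDerivAt (fun x : ℝ => n * (π * x)) (n * (π * 1)) x :=
      ((hasDerivAt_id x).const_mul π).const_mul (n : ℝ)
    have h := ((((hasDerivAt_pow 2 x).mul hl.sin).div_const (π * n)).add
      ((((hasDerivAt_id x).const_mul 2).mul hl.cos).div_const ((π * n) ^ 2))).sub
      ((hl.sin.const_mul 2).div_const ((π * n) ^ 3))
    refine h.congr_deriv ?_
    simp only [id]
    field_simp
    ring
  rw [intervalIntegral.integral_eq_sub_of_hasDerivAt hd
    (by apply Continuous.intervalIntegrable; fun_prop)]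
  simp [Real.sin_nat_mul_pi, Real.cos_nat_mul_pi]

lemma hasSum_re_pow_div {r : ℝ} (hr : 0 ≤ r) (hr1 : r < 1) (θ : ℝ) :
    HasSum (fun n : ℕ => r ^ n / n * Real.cos (n * θ))
      (-Real.log ‖1 - r * Complex.exp (θ * Complex.I)‖) := by
  have hz : ‖(r : ℂ) * Complex.exp (θ * Complex.I)‖ < 1 := by
    rw [norm_mul, Complex.norm_exp_ofReal_mul_I, mul_one, Complex.norm_real]
    simpa [abs_of_nonneg hr] using hr1
  have h := Complex.hasSum_re (Complex.hasSum_taylorSeries_neg_log hz)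
  rw [Complex.neg_re, Complex.log_re] at h
  refine h.congr_fun fun n => ?_
  rw [mul_pow, ← Complex.exp_nat_mul, ← mul_assoc, mul_div_right_comm]
  rw [show ((n : ℂ) * θ) = ((n * θ : ℝ) : ℂ) by push_cast; rfl,
    show ((r : ℂ) ^ n / n) = ((r ^ n / n : ℝ) : ℂ) by push_cast; rfl, Complex.re_ofReal_mul,
    Complex.exp_ofReal_mul_I_re]

lemma integral_sq_mul_log_norm {r : ℝ} (hr : 0 ≤ r) (hr1 : r < 1) :
    ∫ x in (0 : ℝ)..1, x ^ 2 * Real.log ‖1 - r * Complex.exp ((π * x : ℝ) * Complex.I)‖ =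
      ∑' n : ℕ, r ^ n * (-2 * (-1) ^ n / (π ^ 2 * n ^ 3)) := by
  have hgeo := summable_geometric_of_lt_one hr hr1
  have h := intervalIntegral.hasSum_integral_of_dominated_convergence
    (a := 0) (b := 1) (μ := MeasureTheory.volume)
    (F := fun (n : ℕ) (x : ℝ) => x ^ 2 * (-(r ^ n / n * Real.cos (n * (π * x)))))
    (f := fun x => x ^ 2 * Real.log ‖1 - r * Complex.exp ((π * x : ℝ) * Complex.I)‖)
    (fun n _ => r ^ n) (fun n => by
      apply Continuous.aestronglyMeasurable
      fun_prop) (fun n => Filter.Eventually.of_forall fun x hx => by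
      rw [Set.uIoc_of_le zero_le_one] at hx
      have hx2 : x ^ 2 ≤ 1 := by nlinarith [hx.1, hx.2]
      have hrn : 0 ≤ r ^ n := by positivity
      have hdiv : r ^ n / n ≤ r ^ n := by
        rcases Nat.eq_zero_or_pos n with rfl | hn
        · simp
        · exact div_le_self hrn (by exact_mod_cast hn)
      rw [Real.norm_eq_abs, abs_mul, abs_neg, abs_mul, abs_of_nonneg (sq_nonneg x),
        abs_of_nonneg (by positivity : 0 ≤ r ^ n / n)]
      calc _ ≤ 1 * (r ^ n * 1) := by
            gcongr
            exact Real.abs_cos_le_one _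
        _ = _ := by ring)
    (Filter.Eventually.of_forall fun x _ => hgeo) (by simp)
    (Filter.Eventually.of_forall fun x _ => by
      simpa using (hasSum_re_pow_div hr hr1 (π * x)).neg.mul_left (x ^ 2))
  rw [← h.tsum_eq]
  refine tsum_congr fun n => ?_
  rcases eq_or_ne n 0 with rfl | hn
  · simp
  · rw [show (fun x : ℝ => x ^ 2 * (-(r ^ n / n * Real.cos (n * (π * x))))) =
      fun x => -(r ^ n / n) * (x ^ 2 * Real.cos (n * (π * x))) by ext; ring,
      intervalIntegral.integral_const_mul, integral_sq_mul_cos hn]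
    ring

lemma sin_le_norm_one_sub_mul_exp (r θ : ℝ) :
    Real.sin θ ≤ ‖1 - r * Complex.exp (θ * Complex.I)‖ := by
  have h : ‖1 - r * Complex.exp (θ * Complex.I)‖ = ‖Complex.exp ((-θ : ℝ) * Complex.I) - r‖ := by
    have : Complex.exp ((-θ : ℝ) * Complex.I) - r =
        Complex.exp ((-θ : ℝ) * Complex.I) * (1 - r * Complex.exp (θ * Complex.I)) := by
      rw [mul_sub, mul_left_comm, ← Complex.exp_add]
      simp
    rw [this, norm_mul, Complex.norm_exp_ofReal_mul_I, one_mul]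
  rw [h]
  refine le_trans ?_ (Complex.abs_im_le_norm _)
  rw [Complex.sub_im, Complex.exp_ofReal_mul_I_im, Complex.ofReal_im, sub_zero, Real.sin_neg,
    abs_neg]
  exact le_abs_self _

lemma norm_one_sub_exp {θ : ℝ} (h0 : 0 ≤ θ) (h1 : θ ≤ π) :
    ‖1 - Complex.exp (θ * Complex.I)‖ = 2 * Real.sin (θ / 2) := by
  have hs : 0 ≤ Real.sin (θ / 2) := Real.sin_nonneg_of_nonneg_of_le_pi (by linarith) (by linarith)
  rw [norm_sub_rev, mul_comm (θ : ℂ), Complex.norm_exp_I_mul_ofReal_sub_one, Real.norm_eq_abs,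
    abs_of_nonneg (by positivity)]

lemma intervalIntegrable_log_sin_mul {c : ℝ} (hc : c ≠ 0) :
    IntervalIntegrable (fun x : ℝ => Real.log (Real.sin (c * x))) MeasureTheory.volume 0 1 := by
  have h := (intervalIntegrable_log_sin (a := 0) (b := c)).comp_mul_left (c := c)
  simpa [hc] using h

lemma tsum_neg_one_pow_div_cube :
    ∑' n : ℕ, (-2 * (-1) ^ n / (π ^ 2 * n ^ 3) : ℝ) = 3 / (2 * π ^ 2) * realZeta 3 := by
  have hz := hasSum_realZeta (s := 3) (by norm_num)
  have hall : HasSum (fun n : ℕ => 1 / (n : ℝ) ^ 3) (realZeta 3) := by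
    rw [← hasSum_nat_add_iff' 1]
    simpa using hz
  have heven : HasSum (fun n : ℕ => (1 + (-1) ^ (2 * n)) / ((2 * n : ℕ) : ℝ) ^ 3)
      (1 / 4 * realZeta 3) := by
    refine (hall.mul_left (1 / 4)).congr_fun fun n => ?_
    rw [pow_mul]
    push_cast
    rw [mul_pow]
    ring
  have hodd : HasSum (fun n : ℕ => (1 + (-1) ^ (2 * n + 1)) / ((2 * n + 1 : ℕ) : ℝ) ^ 3) 0 := by
    refine hasSum_zero.congr_fun fun n => ?_
    rw [pow_succ, pow_mul]
    simp
  have h := ((heven.even_add_odd (f := fun n : ℕ => (1 + (-1) ^ n) / (n : ℝ) ^ 3) hodd).sub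
    hall).mul_left (-2 / π ^ 2)
  calc ∑' n : ℕ, (-2 * (-1) ^ n / (π ^ 2 * n ^ 3) : ℝ)
      = -2 / π ^ 2 * (1 / 4 * realZeta 3 + 0 - realZeta 3) := by
        rw [← h.tsum_eq]
        exact tsum_congr fun n => by ring
    _ = 3 / (2 * π ^ 2) * realZeta 3 := by ring

lemma integral_sq_mul_log_two_sin :
    ∫ x in (0 : ℝ)..1, x ^ 2 * Real.log (2 * Real.sin (π / 2 * x)) =
      3 / (2 * π ^ 2) * realZeta 3 := by
  rw [← tsum_neg_one_pow_div_cube]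
  have hbound : Summable fun n : ℕ => 2 / π ^ 2 * (1 / (n : ℝ) ^ 3) :=
    (Real.summable_one_div_nat_pow.2 (by norm_num)).mul_left _
  have hr : ∀ᶠ r : ℝ in nhdsWithin 1 (Set.Iio 1), 0 ≤ r ∧ r < 1 := by
    filter_upwards [Ioo_mem_nhdsLT (zero_lt_one' ℝ)] with r hr using ⟨hr.1.le, hr.2⟩
  have hright : Filter.Tendsto (fun r : ℝ => ∑' n : ℕ, r ^ n * (-2 * (-1) ^ n / (π ^ 2 * n ^ 3)))
      (nhdsWithin 1 (Set.Iio 1)) (nhds (∑' n : ℕ, (-2 * (-1) ^ n / (π ^ 2 * n ^ 3) : ℝ))) := by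
    refine tendsto_tsum_of_dominated_convergence hbound (fun n => ?_) ?_
    · have hc : Continuous fun r : ℝ => r ^ n * (-2 * (-1) ^ n / (π ^ 2 * n ^ 3)) := by fun_prop
      simpa using (hc.tendsto 1).mono_left nhdsWithin_le_nhds
    · filter_upwards [hr] with r hr n
      rw [norm_mul, norm_pow, Real.norm_of_nonneg hr.1]
      have : ‖(-2 * (-1) ^ n / (π ^ 2 * n ^ 3) : ℝ)‖ = 2 / π ^ 2 * (1 / (n : ℝ) ^ 3) := by
        rw [norm_div, norm_mul, norm_pow]
        simp
        ring
      rw [this]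
      exact mul_le_of_le_one_left (by positivity) (pow_le_one₀ hr.1 hr.2.le)
  have hleft : Filter.Tendsto (fun r : ℝ => ∫ x in (0 : ℝ)..1,
        x ^ 2 * Real.log ‖1 - r * Complex.exp ((π * x : ℝ) * Complex.I)‖)
      (nhdsWithin 1 (Set.Iio 1))
      (nhds (∫ x in (0 : ℝ)..1, x ^ 2 * Real.log (2 * Real.sin (π / 2 * x)))) := by
    have hae : ∀ᵐ x : ℝ, x ≠ 1 := MeasureTheory.Measure.ae_ne _ 1
    refine intervalIntegral.tendsto_integral_filter_of_dominated_convergence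
      (fun x => Real.log 2 + -Real.log (Real.sin (π * x))) ?_ ?_ ?_ ?_
    · refine Filter.Eventually.of_forall fun r => Measurable.aestronglyMeasurable ?_
      fun_prop
    · filter_upwards [hr] with r hr
      filter_upwards [hae] with x hx1 hx
      rw [Set.uIoc_of_le zero_le_one] at hx
      have hlt : x < 1 := lt_of_le_of_ne hx.2 hx1
      have hsin : 0 < Real.sin (π * x) := Real.sin_pos_of_pos_of_lt_pi
        (mul_pos Real.pi_pos hx.1) (by nlinarith [Real.pi_pos])
      have hlow := sin_le_norm_one_sub_mul_exp r (π * x)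
      have hup : ‖1 - r * Complex.exp ((π * x : ℝ) * Complex.I)‖ ≤ 2 := by
        refine (norm_sub_le _ _).trans ?_
        rw [norm_mul, Complex.norm_exp_ofReal_mul_I, Complex.norm_real, Real.norm_of_nonneg hr.1]
        simp
        linarith [hr.2]
      have h1 := Real.log_le_log hsin hlow
      have h2 := Real.log_le_log (hsin.trans_le hlow) hup
      have h3 := Real.log_nonpos hsin.le (Real.sin_le_one _)
      have h4 : 0 ≤ Real.log 2 := Real.log_nonneg (by norm_num)
      rw [norm_mul, Real.norm_of_nonneg (sq_nonneg x), Real.norm_eq_abs]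
      have hx2 : x ^ 2 ≤ 1 := by nlinarith [hx.1]
      refine (mul_le_of_le_one_left (abs_nonneg _) hx2).trans ?_
      rw [abs_le]
      constructor <;> linarith
    · exact intervalIntegrable_const.add (intervalIntegrable_log_sin_mul Real.pi_ne_zero).neg
    · filter_upwards with x hx
      rw [Set.uIoc_of_le zero_le_one] at hx
      have hpos : 0 < Real.sin (π / 2 * x) := Real.sin_pos_of_pos_of_lt_pi
        (mul_pos (by positivity) hx.1) (by nlinarith [Real.pi_pos, hx.2])
      have hn : ‖1 - ((1 : ℝ) : ℂ) * Complex.exp ((π * x : ℝ) * Complex.I)‖ =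
          2 * Real.sin (π / 2 * x) := by
        rw [Complex.ofReal_one, one_mul, norm_one_sub_exp (by nlinarith [Real.pi_pos, hx.1])
          (by nlinarith [Real.pi_pos, hx.2])]
        ring_nf
      have hc : ContinuousAt (fun r : ℝ =>
          x ^ 2 * Real.log ‖1 - r * Complex.exp ((π * x : ℝ) * Complex.I)‖) 1 := by
        refine continuousAt_const.mul (ContinuousAt.log (by fun_prop) ?_)
        rw [hn]
        positivity
      have := hc.tendsto.mono_left (nhdsWithin_le_nhds (s := Set.Iio 1))
      rwa [hn] at this
  refine tendsto_nhds_unique hleft (hright.congr' ?_)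
  filter_upwards [hr] with r hr using (integral_sq_mul_log_norm hr.1 hr.2).symm

lemma integral_pow_mul_one_sub_sq (m : ℕ) :
    ∫ x in (0 : ℝ)..1, x ^ m * (1 - x) ^ 2 = 2 / (((m : ℝ) + 1) * (m + 2) * (m + 3)) := by
  have hd : ∀ x ∈ Set.uIcc (0 : ℝ) 1, HasDerivAt
      (fun x : ℝ => x ^ (m + 1) / (m + 1) - 2 * x ^ (m + 2) / (m + 2) + x ^ (m + 3) / (m + 3))
      (x ^ m * (1 - x) ^ 2) x := fun x _ => by
    have h := (((hasDerivAt_pow (m + 1) x).div_const (m + 1 : ℝ)).sub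
      (((hasDerivAt_pow (m + 2) x).const_mul 2).div_const (m + 2 : ℝ))).add
      ((hasDerivAt_pow (m + 3) x).div_const (m + 3 : ℝ))
    refine h.congr_deriv ?_
    simp only [Nat.add_sub_cancel, show m + 2 - 1 = m + 1 from rfl, show m + 3 - 1 = m + 2 from rfl]
    push_cast
    field_simp
    ring
  rw [intervalIntegral.integral_eq_sub_of_hasDerivAt hd
    (by apply Continuous.intervalIntegrable; fun_prop)]
  simp
  field_simp
  ring

/-- The `n`-th term of the series, written with real numbers. -/
noncomputable def zetaThreeTerm (n : ℕ) : ℝ :=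
  (1 - (1 / 4) ^ (n + 1)) * realZeta (2 * (n + 1)) / ((n : ℝ) + 1) /
    ((2 * n + 3) * (2 * n + 4) * (2 * n + 5))

lemma one_sub_quarter_pow_nonneg (n : ℕ) : (0 : ℝ) ≤ 1 - (1 / 4) ^ (n + 1) := by
  rw [sub_nonneg]
  exact pow_le_one₀ (by norm_num) (by norm_num)

lemma summable_zetaThreeTerm : Summable zetaThreeTerm := by
  have h := (hasSum_realZeta one_lt_two).summable.mul_left (realZeta 2)
  refine Summable.of_nonneg_of_le (fun n => ?_) (fun n => ?_) h
  · have := one_sub_quarter_pow_nonneg n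
    have := realZeta_nonneg (2 * (n + 1))
    unfold zetaThreeTerm
    positivity
  · have h1 : (1 - (1 / 4) ^ (n + 1)) * realZeta (2 * (n + 1)) ≤ realZeta 2 :=
      (mul_le_of_le_one_left (realZeta_nonneg _) (sub_le_self _ (by positivity))).trans
        (realZeta_le (by lia))
    have h2 : ((n : ℝ) + 1) ^ 2 ≤ (n + 1) * ((2 * n + 3) * (2 * n + 4) * (2 * n + 5)) := by
      rw [sq]
      gcongr
      have hn : (0 : ℝ) ≤ n := n.cast_nonneg
      have : (0 : ℝ) ≤ n ^ 2 := by positivity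
      have : (0 : ℝ) ≤ n ^ 3 := by positivity
      nlinarith
    rw [zetaThreeTerm, div_div, mul_one_div]
    exact div_le_div₀ (realZeta_nonneg 2) h1 (by positivity) h2

lemma hasSum_zetaThreeTerm_integral :
    HasSum zetaThreeTerm
      (∫ x in (0 : ℝ)..1, -(1 / 2) * ((1 - x) ^ 2 * Real.log (Real.cos (π / 2 * x)))) := by
  let c : ℕ → ℝ := fun n => (1 - (1 / 4) ^ (n + 1)) * realZeta (2 * (n + 1)) / ((n : ℝ) + 1) / 2
  have hc : ∀ n, 0 ≤ c n := fun n => by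
    have := one_sub_quarter_pow_nonneg n
    have := realZeta_nonneg (2 * (n + 1))
    positivity
  let F : ℕ → ℝ → ℝ := fun n x => c n * (x ^ (2 * (n + 1)) * (1 - x) ^ 2)
  have hF : ∀ n, ∫ x in (0 : ℝ)..1, F n x = zetaThreeTerm n := fun n => by
    rw [intervalIntegral.integral_const_mul, integral_pow_mul_one_sub_sq, zetaThreeTerm]
    simp only [c]
    push_cast
    field_simp
    ring
  have hFn : ∀ n x, ‖F n x‖ = F n x := fun n x => by
    refine Real.norm_of_nonneg (mul_nonneg (hc n) ?_)
    rw [pow_mul]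
    positivity
  have hFi : ∀ n, ∫ x in Set.Ioc (0 : ℝ) 1, F n x = zetaThreeTerm n := fun n => by
    rw [← intervalIntegral.integral_of_le zero_le_one, hF]
  have h := MeasureTheory.hasSum_integral_of_summable_integral_norm
    (μ := MeasureTheory.volume.restrict (Set.Ioc (0 : ℝ) 1)) (F := F)
    (fun n => by
      have : Continuous (F n) := by fun_prop
      exact this.integrableOn_Ioc)
    (by simpa only [hFn, hFi] using summable_zetaThreeTerm)
  simp only [hFi] at h
  rw [intervalIntegral.integral_of_le zero_le_one]
  convert! h using 1
  refine MeasureTheory.integral_congr_ae ?_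
  rw [Filter.EventuallyEq, MeasureTheory.ae_restrict_iff' measurableSet_Ioc]
  filter_upwards [MeasureTheory.Measure.ae_ne MeasureTheory.volume (1 : ℝ)] with x hx1 hx
  have hs := (hasSum_neg_log_cos hx.1 (lt_of_le_of_ne hx.2 hx1)).mul_left ((1 - x) ^ 2 / 2)
  have hterm : (F · x) = fun n : ℕ => (1 - x) ^ 2 / 2 * ((1 - (1 / 4) ^ (n + 1)) *
      realZeta (2 * (n + 1)) * x ^ (2 * (n + 1)) / ((n : ℝ) + 1)) := by
    ext n
    simp only [F, c]
    ring
  rw [hterm, hs.tsum_eq]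
  ring

lemma integral_one_sub_sq_mul_log_cos :
    ∫ x in (0 : ℝ)..1, (1 - x) ^ 2 * Real.log (Real.cos (π / 2 * x)) =
      3 / (2 * π ^ 2) * realZeta 3 - Real.log 2 / 3 := by
  have hflip : ∫ x in (0 : ℝ)..1, (1 - x) ^ 2 * Real.log (Real.cos (π / 2 * x)) =
      ∫ x in (0 : ℝ)..1, x ^ 2 * Real.log (Real.sin (π / 2 * x)) := by
    have h := intervalIntegral.integral_comp_sub_left (a := 0) (b := 1)
      (fun x : ℝ => x ^ 2 * Real.log (Real.sin (π / 2 * x))) 1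
    simp only [sub_self, sub_zero] at h
    rw [← h]
    congr 1 with x
    rw [show π / 2 * (1 - x) = π / 2 - π / 2 * x by ring, Real.sin_pi_div_two_sub]
  have hint : IntervalIntegrable (fun x : ℝ => x ^ 2 * Real.log (Real.sin (π / 2 * x)))
      MeasureTheory.volume 0 1 :=
    (intervalIntegrable_log_sin_mul (by positivity)).continuousOn_mul
      (continuous_pow 2).continuousOn
  have hsplit : ∫ x in (0 : ℝ)..1, x ^ 2 * Real.log (2 * Real.sin (π / 2 * x)) =
      ∫ x in (0 : ℝ)..1, (Real.log 2 * x ^ 2 + x ^ 2 * Real.log (Real.sin (π / 2 * x))) := by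
    refine intervalIntegral.integral_congr_ae (Filter.Eventually.of_forall fun x hx => ?_)
    rw [Set.uIoc_of_le zero_le_one] at hx
    have hpos : 0 < Real.sin (π / 2 * x) := Real.sin_pos_of_pos_of_lt_pi
      (mul_pos (by positivity) hx.1) (by nlinarith [Real.pi_pos, hx.2])
    rw [Real.log_mul two_ne_zero hpos.ne']
    ring
  rw [integral_sq_mul_log_two_sin, intervalIntegral.integral_add
    (by apply Continuous.intervalIntegrable; fun_prop) hint, intervalIntegral.integral_const_mul,
    integral_pow] at hsplit
  rw [hflip]
  norm_num at hsplit ⊢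
  linarith

lemma hasSum_zetaThreeTerm :
    HasSum zetaThreeTerm (Real.log 2 / 6 - 3 / (4 * π ^ 2) * realZeta 3) := by
  convert hasSum_zetaThreeTerm_integral using 1
  rw [intervalIntegral.integral_const_mul, integral_one_sub_sq_mul_log_cos]
  ring

lemma term_eq_zetaThreeTerm (n : ℕ) :
    (2 - (2 : ℂ) ^ (1 - 2 * ((n : ℤ) + 1))) * Complex.Gamma (2 * ((n : ℂ) + 1)) *
      riemannZeta (2 * ((n : ℂ) + 1)) / Complex.Gamma (2 * ((n : ℂ) + 1) + 4) =
    (zetaThreeTerm n : ℂ) := by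
  have hG : Complex.Gamma (2 * ((n : ℂ) + 1) + 4) = (2 * n + 5) * (2 * n + 4) * (2 * n + 3) *
      (2 * n + 2) * Complex.Gamma (2 * ((n : ℂ) + 1)) := by
    rw [show 2 * ((n : ℂ) + 1) + 4 = ((2 * n + 5 : ℕ) : ℂ) + 1 by push_cast; ring,
      show 2 * ((n : ℂ) + 1) = ((2 * n + 1 : ℕ) : ℂ) + 1 by push_cast; ring,
      Complex.Gamma_nat_eq_factorial, Complex.Gamma_nat_eq_factorial]
    simp only [Nat.factorial_succ]
    push_cast
    ring
  have hG0 : Complex.Gamma (2 * ((n : ℂ) + 1)) ≠ 0 := Complex.Gamma_ne_zero_of_re_pos (by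
    simp; positivity)
  have hz : riemannZeta (2 * ((n : ℂ) + 1)) = (realZeta (2 * (n + 1)) : ℂ) := by
    rw [← riemannZeta_natCast_eq_realZeta (by lia)]
    push_cast
    rfl
  have hp : (2 : ℂ) ^ (1 - 2 * ((n : ℤ) + 1)) = 2 * (1 / 4) ^ (n + 1) := by
    rw [zpow_sub₀ two_ne_zero, zpow_one, zpow_mul, one_div, inv_pow, div_eq_mul_inv]
    norm_cast
  rw [hG, hz, hp, zetaThreeTerm]
  push_cast
  field_simp

/-- `ζ(3) = -(4/3) π² (-log 2 / 6 + Σ_{n=1}^∞ (2 - 2^(1-2n)) Γ(2n) ζ(2n) / Γ(2n+4))`,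
the series converging. -/
theorem stmt_6 :
    (Summable fun n : ℕ =>
      (2 - (2 : ℂ) ^ (1 - 2 * ((n : ℤ) + 1))) * Complex.Gamma (2 * ((n : ℂ) + 1)) *
        riemannZeta (2 * ((n : ℂ) + 1)) / Complex.Gamma (2 * ((n : ℂ) + 1) + 4)) ∧
    riemannZeta 3 =
      -(4 / 3) * (π : ℂ) ^ 2 *
        (-(Real.log 2) / 6 +
          ∑' n : ℕ,
            (2 - (2 : ℂ) ^ (1 - 2 * ((n : ℤ) + 1))) * Complex.Gamma (2 * ((n : ℂ) + 1)) *
              riemannZeta (2 * ((n : ℂ) + 1)) / Complex.Gamma (2 * ((n : ℂ) + 1) + 4)) := by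
  simp only [term_eq_zetaThreeTerm]
  have h := Complex.hasSum_ofReal.2 hasSum_zetaThreeTerm
  refine ⟨h.summable, ?_⟩
  have hp : (π : ℂ) ≠ 0 := by exact_mod_cast Real.pi_ne_zero
  rw [h.tsum_eq, show (3 : ℂ) = ((3 : ℕ) : ℂ) by norm_num,
    riemannZeta_natCast_eq_realZeta (by norm_num)]
  push_cast
  field_simp
  ring
end
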